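/- For each i ≥ −1 and for all n ≥ 1, the number of maximal chains in the Tamari lattice T_n of length n+i satisfies #C_i(n) = Σ_{t=1}^{2i+3} C(n+i, t+i) · #N_i(t), and this expression is a polynomial in n of degree 3i+3. Moreover, for all n ≥ 1, #N_i(n) = Σ_{t=1}^{n} (−1)^{n−t} C(n+i, t+i) · #C_i(t). -/

import Mathlib

/-!
Common definitions for formalizing "A recursion on maximal chains in the Tamari lattices"
(L. Nelson).

* Young diagrams are encoded by their row-length functions `lam : ℕ → ℕ` (rows indexed from 1,
  with `lam 0 = 0`).
* Dyck paths are lists of steps (north/east).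
* Tableaux are encoded by entry functions `f : ℕ × ℕ → ℕ` (1-indexed boxes; value `0` means
  "no box").  The label of box `(x, y)` is `f (x, y)`.
-/

noncomputable section

namespace TamariMaxChains

/-- A step of a lattice path: north or east. -/
inductive Step : Type
  | N : Step
  | E : Step
deriving DecidableEq

/-- Number of north steps of a path. -/
def nCount (p : List Step) : ℕ := p.count Step.N

/-- Number of east steps of a path. -/
def eCount (p : List Step) : ℕ := p.count Step.E

/-- `p` is a Dyck path: equally many norths and easts, and every prefix has at least as many
north steps as east steps (the path never goes below the diagonal `y = x`). -/
def IsDyck (p : List Step) : Prop :=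
  nCount p = eCount p ∧ ∀ q : List Step, q <+: p → eCount q ≤ nCount q

/-- `q` is a prime Dyck path: it meets the slope-one line joining its endpoints only at its
endpoints. -/
def IsPrimeDyck (q : List Step) : Prop :=
  q ≠ [] ∧ nCount q = eCount q ∧
    ∀ s : List Step, s <+: q → s ≠ [] → s ≠ q → eCount s < nCount s

/-- Covering relation of the Tamari lattice on Dyck paths:  `TamariCoverD P' P` means `P'`
covers `P`, i.e. `P'` is obtained from `P` by swapping an east step that is followed by a north
step with the prime Dyck subpath following it. -/
def TamariCoverD (P' P : List Step) : Prop :=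
  ∃ a q b : List Step, IsPrimeDyck q ∧
    P = a ++ Step.E :: (q ++ b) ∧ P' = a ++ (q ++ Step.E :: b)

/-- `lam` is the row-length function of a Young diagram: rows are indexed from `1`,
`lam x` is the number of boxes in row `x`, rows weakly decrease, finitely many boxes. -/
def IsDiagram (lam : ℕ → ℕ) : Prop :=
  lam 0 = 0 ∧ (∀ x, 1 ≤ x → lam (x + 1) ≤ lam x) ∧ ∃ N, ∀ x, N ≤ x → lam x = 0

/-- The height (number of north steps) of the prime path of row `d ≥ 1` of the Young diagram
with row lengths `lam`:  the least `t ≥ 1` such that either `t = d` (row `0` being regarded as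
an infinite row of boxes) or row `d - t` has length at least `lam d + t`. -/
def primeHeight (lam : ℕ → ℕ) (d : ℕ) : ℕ :=
  sInf {t | 1 ≤ t ∧ (t = d ∨ (t < d ∧ lam d + t ≤ lam (d - t)))}

/-- The last box of row `d` is a corner box (last box of its row and lowest box of
its column). -/
def IsCorner (lam : ℕ → ℕ) (d : ℕ) : Prop := 1 ≤ d ∧ 1 ≤ lam d ∧ lam (d + 1) < lam d

/-- The result of removing the `B`-strip of the last box `B` of row `d`: the last box of each of
the rows `d - h + 1, …, d` is removed, where `h` is the height of the prime path of row `d`. -/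
def removeStrip (lam : ℕ → ℕ) (d : ℕ) : ℕ → ℕ := fun x =>
  if d + 1 ≤ x + primeHeight lam d ∧ x ≤ d then lam x - 1 else lam x

/-- Covering relation of the Tamari lattice on Young diagrams:  `mu` covers `lam` iff `mu` is
obtained from `lam` by removing the `B`-strip of a corner box `B`. -/
def TamariCoverY (mu lam : ℕ → ℕ) : Prop := ∃ d, IsCorner lam d ∧ mu = removeStrip lam d

/-- The `B`-strip of the last box `B` of row `d`: the set of last boxes of rows
`d - h + 1, …, d`, where `h` is the height of the prime path of row `d`. -/
def stripSet (lam : ℕ → ℕ) (d : ℕ) : Set (ℕ × ℕ) :=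
  {b | b.2 = lam b.1 ∧ 1 ≤ b.2 ∧ d + 1 ≤ b.1 + primeHeight lam d ∧ b.1 ≤ d}

/-- The enclosure of the `B`-strip of the last box `B = (d, lam d)` of row `d`: all boxes
`(x, y)` with `d - h ≤ x ≤ d` and `lam d ≤ y ≤ lam d + h`, where row `0` is regarded as an
infinite row of boxes. -/
def enclosure (lam : ℕ → ℕ) (d : ℕ) : Set (ℕ × ℕ) :=
  {b | (b.1 = 0 ∨ b.2 ≤ lam b.1) ∧ 1 ≤ b.2 ∧
    d ≤ b.1 + primeHeight lam d ∧ b.1 ≤ d ∧ lam d ≤ b.2 ∧ b.2 ≤ lam d + primeHeight lam d}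

/-- The Dyck path of length `2 n` corresponding to the Young diagram `lam` contained in the
staircase `δ_{n-1}` (the Dyck path is the silhouette of the Young diagram). -/
def toDyck (n : ℕ) (lam : ℕ → ℕ) : List Step :=
  ((List.range n).flatMap fun k =>
    List.replicate (lam (n - k) - lam (n - k + 1)) Step.E ++ [Step.N]) ++
    List.replicate (n - lam 1) Step.E

/-- The prime path of row `d` of the Young diagram `lam`, as its list of steps (read from its
lower-left endpoint). -/
def primePathList (lam : ℕ → ℕ) (d : ℕ) : List Step :=
  Step.N :: ((((List.range (primeHeight lam d - 1)).flatMap fun j =>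
    List.replicate (lam (d - 1 - j) - lam (d - j)) Step.E ++ [Step.N])) ++
    List.replicate (lam d + primeHeight lam d - lam (d - (primeHeight lam d - 1))) Step.E)

/-- `S` translates to `S'` by `p` units down and `q` units to the right. -/
def TranslatesBy (p q : ℤ) (S S' : Set (ℕ × ℕ)) : Prop :=
  ∀ x y : ℕ, (x, y) ∈ S' ↔ ∃ a b : ℕ, (a, b) ∈ S ∧ (x : ℤ) = a + p ∧ (y : ℤ) = b + q

/-- `S` translates to `S'`. -/
def Translates (S S' : Set (ℕ × ℕ)) : Prop := ∃ p q : ℤ, TranslatesBy p q S S'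

/-- The length of a tableau: its number of distinct labels (for an honest tableau, labels are
exactly `1, …, tlen f`). -/
def tlen (f : ℕ × ℕ → ℕ) : ℕ := sSup {v | v ≠ 0 ∧ ∃ b, f b = v}

/-- The number of boxes in row `x` of a tableau. -/
def rowLen (f : ℕ × ℕ → ℕ) (x : ℕ) : ℕ := sSup {y | f (x, y) ≠ 0}

/-- The number of boxes in column `y` of a tableau. -/
def colLen (f : ℕ × ℕ → ℕ) (y : ℕ) : ℕ := sSup {x | f (x, y) ≠ 0}

/-- `f` is (the entry function of) a tableau: the support is a Young diagram (1-indexed),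
rows strictly increase, columns weakly increase, and the set of labels is exactly
`{1, …, tlen f}`. -/
def IsTableau (f : ℕ × ℕ → ℕ) : Prop :=
  (∀ y, f (0, y) = 0) ∧ (∀ x, f (x, 0) = 0) ∧
  {b : ℕ × ℕ | f b ≠ 0}.Finite ∧
  (∀ x y x' y', 1 ≤ x' → x' ≤ x → 1 ≤ y' → y' ≤ y → f (x, y) ≠ 0 → f (x', y') ≠ 0) ∧
  (∀ x y, f (x, y) ≠ 0 → f (x, y + 1) ≠ 0 → f (x, y) < f (x, y + 1)) ∧
  (∀ x y, f (x, y) ≠ 0 → f (x + 1, y) ≠ 0 → f (x, y) ≤ f (x + 1, y)) ∧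
  (∀ v, 1 ≤ v → (v ≤ tlen f ↔ ∃ b, f b = v))

/-- `T^(r)`: the subtableau of all entries at most `r`. -/
def trunc (f : ℕ × ℕ → ℕ) (r : ℕ) : ℕ × ℕ → ℕ := fun b => if f b ≤ r then f b else 0

/-- The shape (row-length function) of a tableau. -/
def shapeOf (f : ℕ × ℕ → ℕ) : ℕ → ℕ := fun x => rowLen f x

/-- The row index of the end-box of the `k`-set of `f` (the maximal row index of a box
labeled `k`). -/
def endRow (f : ℕ × ℕ → ℕ) (k : ℕ) : ℕ := sSup {x | ∃ y, f (x, y) = k}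

/-- `Y 0 ⋗ Y 1 ⋗ ⋯ ⋗ Y l` is a saturated chain in the Tamari order on Young diagrams whose
maximal element `Y 0` is the empty diagram (each `Y r` covers `Y (r+1)`). -/
def IsTamariChain (Y : ℕ → ℕ → ℕ) (l : ℕ) : Prop :=
  (∀ r, r ≤ l → IsDiagram (Y r)) ∧ (∀ x, Y 0 x = 0) ∧
    ∀ r, r < l → TamariCoverY (Y r) (Y (r + 1))

/-- The tableau `ψ(C)` of the saturated chain `C = (∅ = Y 0 ⋗ ⋯ ⋗ Y l)`: the boxes removed in
the transition `Y (r-1) ⋗ Y r` are labeled `r`; that is, each box of `Y l` is labeled by the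
least `r` such that the box belongs to `Y r`. -/
def psiFun (Y : ℕ → ℕ → ℕ) (l : ℕ) : ℕ × ℕ → ℕ := fun b =>
  if 1 ≤ b.1 ∧ 1 ≤ b.2 ∧ b.2 ≤ Y l b.1 then sInf {r | r ≤ l ∧ b.2 ≤ Y r b.1} else 0

/-- `f` is a `ψ`-tableau: it is in the image of `ψ`. -/
def IsPsiTab (f : ℕ × ℕ → ℕ) : Prop :=
  ∃ l Y, IsTamariChain Y l ∧ f = psiFun Y l

/-- Row lengths of the staircase shape `δ_{n-1} = (n-1, n-2, …, 1)`: row `x ≥ 1` has `n - x`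
boxes. -/
def dstair (n : ℕ) : ℕ → ℕ := fun x => if x = 0 then 0 else n - x

/-- `C_i(n)`, via `ψ`: the set of maximal chains of length `n + i` in the Tamari lattice `T_n`,
identified with the `ψ`-tableaux of length `n + i` and shape `δ_{n-1}`. -/
def MemC (i : ℤ) (n : ℕ) (f : ℕ × ℕ → ℕ) : Prop :=
  IsTableau f ∧ IsPsiTab f ∧ (∀ x, rowLen f x = dstair n x) ∧ (tlen f : ℤ) = (n : ℤ) + i

/-- The `r`-set of `f` (of shape `δ_{n-1}`) is a full-set with end-box `(k, n - k)`:
it begins in row `1` and ends in the outer diagonal, at the box `(k, n - k)`. -/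
def HasFullSetAt (f : ℕ × ℕ → ℕ) (n r k : ℕ) : Prop :=
  (∃ y, f (1, y) = r) ∧ 1 ≤ k ∧ k ≤ n - 1 ∧ f (k, n - k) = r ∧
    ∀ x y, f (x, y) = r → x ≤ k

/-- `f` has an `r`-full-set. -/
def HasFullSet (f : ℕ × ℕ → ℕ) (n r : ℕ) : Prop := ∃ k, HasFullSetAt f n r k

/-- `f` has an `r⁺`-full-set (plus-full-set): an `r`-full-set whose end-box `(k, n-k)` satisfies
`k = n - 1`, or `k ≤ n - 2` and the southwest neighbor has a smaller label. -/
def HasPlusFullSet (f : ℕ × ℕ → ℕ) (n r : ℕ) : Prop :=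
  ∃ k, HasFullSetAt f n r k ∧ (k = n - 1 ∨ (k ≤ n - 2 ∧ f (k + 1, n - k - 1) < r))

/-- `F_i^r(n)`: the set of `C ∈ C_i(n)` whose `r`-set is a plus-full-set and whose `j`-set is
not a plus-full-set for any `j ∈ [r-1]`. -/
def MemF (i : ℤ) (n : ℕ) (r : ℕ) (f : ℕ × ℕ → ℕ) : Prop :=
  MemC i n f ∧ HasPlusFullSet f n r ∧ ∀ j, 1 ≤ j → j < r → ¬ HasPlusFullSet f n j

/-- `N_i(n)`: the set of `C ∈ C_i(n)` having no plus-full-sets. -/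
def MemN (i : ℤ) (n : ℕ) (f : ℕ × ℕ → ℕ) : Prop :=
  MemC i n f ∧ ∀ r, ¬ HasPlusFullSet f n r

/-- `α_d`: shift all rows of index greater than `d` down one row and repeat row `d` in
row `d + 1`. -/
def alphaFun (d : ℕ) (f : ℕ × ℕ → ℕ) : ℕ × ℕ → ℕ := fun b =>
  if b.1 ≤ d then f b else f (b.1 - 1, b.2)

/-- `β_d`: append a box labeled `tlen f + 1` at the end of each of the rows `1, …, d`. -/
def betaFun (d : ℕ) (f : ℕ × ℕ → ℕ) : ℕ × ℕ → ℕ := fun b =>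
  if 1 ≤ b.1 ∧ b.1 ≤ d ∧ b.2 = rowLen f b.1 + 1 then tlen f + 1 else f b

/-- The number of boxes of row `x` of `f` whose label is at most `r` (these occupy an initial
segment of the row). -/
def lowLen (f : ℕ × ℕ → ℕ) (r x : ℕ) : ℕ := sSup {y | f (x, y) ≠ 0 ∧ f (x, y) ≤ r}

/-- The row index `d` used in the definition of `Ĉ(r)`: the minimal `k ∈ [n-1]` with
`C (k, n-k) ≤ r` if such `k` exists, and `n` otherwise. -/
def hatD (f : ℕ × ℕ → ℕ) (n r : ℕ) : ℕ :=
  sInf ({k | 1 ≤ k ∧ k ≤ n - 1 ∧ 1 ≤ f (k, n - k) ∧ f (k, n - k) ≤ r} ∪ {n})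

/-- `Ĉ(r)` for `C ∈ C_i(n)` and `0 ≤ r ≤ n + i`: starting from `β_d(α_d(C^(r)))` (where `d` is
as in `hatD`), the entries of `C` greater than `r` of row index less than `d` are translated one
unit to the right, those of row index greater than `d` are translated one unit down, and all
these labels are incremented by one. -/
def hatFun (f : ℕ × ℕ → ℕ) (n r : ℕ) : ℕ × ℕ → ℕ := fun b =>
  let d := hatD f n r
  let x := b.1
  let y := b.2
  if x = 0 ∨ y = 0 then 0
  else if x ≤ d then
    if f (x, y) ≠ 0 ∧ f (x, y) ≤ r then f (x, y)
    else if y = lowLen f r x + 1 then r + 1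
    else if r < f (x, y - 1) then f (x, y - 1) + 1
    else 0
  else if x = d + 1 then f (d, y)
  else if f (x - 1, y) = 0 then 0
  else if f (x - 1, y) ≤ r then f (x - 1, y)
  else f (x - 1, y) + 1

/-- `RepBy i m t r C0 C` : `C = (φ_{i,m+t-1}^{r 1} ∘ φ_{i,m+t-2}^{r 2} ∘ ⋯ ∘ φ_{i,m}^{r t}) C0`,
each factor being applied within its domain. -/
def RepBy (i : ℤ) (m t : ℕ) (r : ℕ → ℕ) (C0 C : ℕ × ℕ → ℕ) : Prop :=
  ∃ D : ℕ → ℕ × ℕ → ℕ, D 0 = C0 ∧ D t = C ∧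
    ∀ s, s < t →
      MemC i (m + s) (D s) ∧
      ((r (t - s) : ℤ) ≤ (m : ℤ) + s + i) ∧
      (∀ j, 1 ≤ j → j ≤ r (t - s) → ¬ HasPlusFullSet (D s) (m + s) j) ∧
      D (s + 1) = hatFun (D s) (m + s) (r (t - s))

/-- The set `𝕏_{d,n-1}^r` of Theorem 4.3: `ψ`-tableaux of length `r`, contained in `δ_{n-1}`,
whose row `d` has length `n - d` and whose prime path of row `d` has height `d`. -/
def MemX (d n r : ℕ) (f : ℕ × ℕ → ℕ) : Prop :=
  IsTableau f ∧ IsPsiTab f ∧ tlen f = r ∧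
    (∀ x, 1 ≤ x → rowLen f x ≤ n - x) ∧
    rowLen f d = n - d ∧
    primeHeight (shapeOf f) d = d

/-- The set `ℤ_{d,n}^{r+1}` of Theorem 4.3: `ψ`-tableaux of length `r + 1`, contained in `δ_n`,
such that rows `d` and `d+1` of the truncation at `r` are identical, the end-box of the
`(r+1)`-set is `(d, n-d+1)`, and the prime path of `(d, n-d+1)` has height `d`. -/
def MemZ (d n r : ℕ) (g : ℕ × ℕ → ℕ) : Prop :=
  IsTableau g ∧ IsPsiTab g ∧ tlen g = r + 1 ∧
    (∀ x, 1 ≤ x → rowLen g x ≤ n + 1 - x) ∧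
    (∀ y, trunc g r (d, y) = trunc g r (d + 1, y)) ∧
    g (d, n - d + 1) = r + 1 ∧ (∀ x y, g (x, y) = r + 1 → x ≤ d) ∧
    primeHeight (shapeOf g) d = d

/-! ### Abstract chains

A diagram `lam` is encoded by `a x = lam x + x`. -/

/-- One step of a chain: the entries in rows `p + 1, …, e` are incremented. -/
def St (a b : ℕ → ℕ) : Prop :=
  ∃ p e, p < e ∧ (p = 0 ∨ a e < a p) ∧ (∀ x, p < x → x < e → a x < a e) ∧
    ∀ x, b x = if p < x ∧ x ≤ e then a x + 1 else a x

/-- Maximal chains of length `l` in `T_n`. -/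
structure Ch (n l : ℕ) (A : ℕ → ℕ → ℕ) : Prop where
  zero : ∀ x, A 0 x = x
  step : ∀ s, s < l → St (A s) (A (s + 1))
  fin : ∀ s, l ≤ s → ∀ x, A s x = if x = 0 then 0 else max x n

theorem Ch.step' {n l A} (h : Ch n l A) (s : ℕ) : St (A s) (A (s + 1)) ∨ A (s + 1) = A s := by
  by_cases hs : s < l
  · exact Or.inl (h.step s hs)
  · right
    funext x
    rw [h.fin s (by omega), h.fin (s + 1) (by omega)]

theorem Ch.row0 {n l A} (h : Ch n l A) (s : ℕ) : A s 0 = 0 := by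
  induction s with
  | zero => exact h.zero 0
  | succ s ih =>
    rcases h.step' s with ⟨p, e, _, _, _, hb⟩ | hs
    · rw [hb]; simp [ih]
    · rw [hs, ih]

theorem Ch.mono_succ {n l A} (h : Ch n l A) (s x : ℕ) :
    A s x ≤ A (s + 1) x ∧ A (s + 1) x ≤ A s x + 1 := by
  rcases h.step' s with ⟨p, e, _, _, _, hb⟩ | hs
  · rw [hb]; split_ifs <;> omega
  · rw [hs]; omega

theorem Ch.mono {n l A} (h : Ch n l A) {s s' : ℕ} (hs : s ≤ s') (x : ℕ) : A s x ≤ A s' x := by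
  induction s', hs using Nat.le_induction with
  | base => exact le_rfl
  | succ k _ ih => exact ih.trans (h.mono_succ k x).1

theorem Ch.ge {n l A} (h : Ch n l A) (s x : ℕ) : x ≤ A s x := by
  have := h.mono (Nat.zero_le s) x
  rwa [h.zero] at this

theorem Ch.le {n l A} (h : Ch n l A) (s x : ℕ) : A s x ≤ max x n := by
  have h1 := h.mono (Nat.le_add_right s l) x
  rw [h.fin (s + l) (by omega)] at h1
  split_ifs at h1 <;> omega

theorem Ch.anti {n l A} (h : Ch n l A) (s x : ℕ) (hx : 1 ≤ x) : A s (x + 1) ≤ A s x + 1 := by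
  induction s with
  | zero => simp [h.zero]
  | succ s ih =>
    rcases h.step' s with ⟨p, e, hpe, hp, hlt, hb⟩ | hs
    · rw [hb, hb]
      by_cases hxp : x = p
      · subst hxp
        by_cases hxe : x + 1 = e
        · subst hxe; split_ifs <;> omega
        · have := hlt (x + 1) (by omega) (by omega)
          split_ifs <;> omega
      · split_ifs <;> omega
    · rw [hs]; exact ih

theorem Ch.dom {n l A} (h : Ch n l A) {s s' p q : ℕ} (hp : 1 ≤ p) (hs : s ≤ s')
    (hd : ∀ x, p ≤ x → x ≤ q → A s x ≤ A s p) : ∀ x, p ≤ x → x ≤ q → A s' x ≤ A s' p := by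
  induction s', hs using Nat.le_induction with
  | base => exact hd
  | succ k _ ih =>
    intro x hx hxq
    rcases h.step' k with ⟨p', e, hpe, hp', hlt, hb⟩ | hs
    · rw [hb, hb]
      have h1 := ih x hx hxq
      by_cases hc : p ≤ p' ∧ p' < x ∧ x ≤ e
      · have h2 := ih p' hc.1 (by omega)
        have h3 : A k x ≤ A k e := by
          rcases Nat.lt_or_ge x e with h | h
          · exact (hlt x hc.2.1 h).le
          · have : x = e := by omega
            rw [this]
        split_ifs <;> omega
      · split_ifs <;> omega
    · rw [hs]; exact ih x hx hxq

/-- A step ends in a row which is not yet full. -/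
theorem Ch.step_data {n l A} (h : Ch n l A) {s : ℕ} (hs : s < l) :
    ∃ p e, p < e ∧ (p = 0 ∨ A s e < A s p) ∧ (∀ x, p < x → x < e → A s x < A s e) ∧
    (∀ x, A (s + 1) x = if p < x ∧ x ≤ e then A s x + 1 else A s x) ∧ e < n ∧ A s e < n := by
  obtain ⟨p, e, hpe, hp, hlt, hb⟩ := h.step s hs
  have h1 := hb e
  have h2 := h.le (s + 1) e
  have h3 := h.ge s e
  rw [if_pos ⟨hpe, le_rfl⟩] at h1
  exact ⟨p, e, hpe, hp, hlt, hb, by omega, by omega⟩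

/-- `k` is the first full row at time `s`. -/
def IsD (A : ℕ → ℕ → ℕ) (n s k : ℕ) : Prop :=
  1 ≤ k ∧ n ≤ A s k ∧ ∀ x, 1 ≤ x → x < k → A s x < n

theorem IsD.unique {A n s k k'} (h : IsD A n s k) (h' : IsD A n s k') : k = k' := by
  rcases lt_trichotomy k k' with hk | hk | hk
  · have := h'.2.2 k h.1 hk
    have := h.2.1
    omega
  · exact hk
  · have := h.2.2 k' h'.1 hk
    have := h'.2.1
    omega

theorem Ch.isD_le {n l A} (h : Ch n l A) (hn : 1 ≤ n) {s k : ℕ} (hk : IsD A n s k) : k ≤ n := by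
  by_contra hc
  have := hk.2.2 n hn (by omega)
  have := h.ge s n
  omega

theorem Ch.exists_isD {n l A} (h : Ch n l A) (hn : 1 ≤ n) (s : ℕ) : ∃ k, IsD A n s k := by
  classical
  have hex : ∃ k, 1 ≤ k ∧ n ≤ A s k := ⟨n, hn, h.ge s n⟩
  refine ⟨Nat.find hex, (Nat.find_spec hex).1, (Nat.find_spec hex).2, ?_⟩
  intro x hx hxk
  have := Nat.find_min hex hxk
  by_contra hc
  exact this ⟨hx, by omega⟩

/-- The label `s + 1` is a plus-full-set. -/
def Plus (A : ℕ → ℕ → ℕ) (n s : ℕ) : Prop :=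
  ∃ k, IsD A n s (k + 1) ∧ IsD A n (s + 1) k

/-- Insertion map. -/
def hat (r D : ℕ) (A : ℕ → ℕ → ℕ) : ℕ → ℕ → ℕ := fun s x =>
  if s ≤ r then (if x ≤ D then A s x else A s (x - 1) + 1)
  else if x = 0 then 0 else if x ≤ D then A (s - 1) x + 1 else A (s - 1) (x - 1) + 1

/-- Deletion map. -/
def unhat (r D : ℕ) (B : ℕ → ℕ → ℕ) : ℕ → ℕ → ℕ := fun s x =>
  if s ≤ r then (if x ≤ D then B s x else B s (x + 1) - 1)
  else if x = 0 then 0 else if x ≤ D then B (s + 1) x - 1 else B (s + 1) (x + 1) - 1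

theorem hat_le_lo {r D A s x} (hs : s ≤ r) (hx : x ≤ D) : hat r D A s x = A s x := by
  simp [hat, hs, hx]

theorem hat_le_hi {r D A s x} (hs : s ≤ r) (hx : D < x) :
    hat r D A s x = A s (x - 1) + 1 := by
  simp [hat, hs, hx]

theorem hat_gt_lo {r D A s x} (hs : r < s) (hx0 : 1 ≤ x) (hx : x ≤ D) :
    hat r D A s x = A (s - 1) x + 1 := by
  simp [hat, Nat.not_le.2 hs, hx, Nat.ne_of_gt hx0]

theorem hat_gt_hi {r D A s x} (hs : r < s) (hx : D < x) :
    hat r D A s x = A (s - 1) (x - 1) + 1 := by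
  have : x ≠ 0 := by omega
  simp [hat, Nat.not_le.2 hs, Nat.not_le.2 hx, this]

theorem hat_gt_zero {r D A s} (hs : r < s) : hat r D A s 0 = 0 := by
  simp [hat, Nat.not_le.2 hs]

theorem hat_ch {n l r D A} (hn : 1 ≤ n) (h : Ch n l A) (hr : r ≤ l) (hD : IsD A n r D) :
    Ch (n + 1) (l + 1) (hat r D A) := by
  have hDn := h.isD_le hn hD
  obtain ⟨hD1, hDf, hDlt⟩ := hD
  refine ⟨?_, ?_, ?_⟩
  · intro x
    rcases Nat.lt_or_ge D x with hx | hx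
    · rw [hat_le_hi (Nat.zero_le _) hx, h.zero]; omega
    · rw [hat_le_lo (Nat.zero_le _) hx, h.zero]
  · intro s hs
    rcases lt_trichotomy s r with hsr | hsr | hsr
    · obtain ⟨p, e, hpe, hp, hlt, hb, hen, hef⟩ := h.step_data (show s < l by omega)
      rcases Nat.lt_or_ge e D with he | he
      · refine ⟨p, e, hpe, ?_, ?_, ?_⟩
        · rw [hat_le_lo (by omega) (by omega), hat_le_lo (by omega) (by omega)]; exact hp
        · intro x hx1 hx2
          rw [hat_le_lo (by omega) (by omega), hat_le_lo (by omega) (by omega)]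
          exact hlt x hx1 hx2
        · intro x
          rcases Nat.lt_or_ge D x with hx | hx
          · rw [hat_le_hi (by omega) hx, hat_le_hi (by omega) hx, hb, if_neg (by omega),
              if_neg (by omega)]
          · rw [hat_le_lo (by omega) hx, hat_le_lo (by omega) hx, hb]
      · rcases Nat.lt_or_ge p D with hpD | hpD
        · have hp0 : p = 0 := by
            by_contra hp0
            have hdom := h.dom (s := s + 1) (s' := r) (p := p) (q := e) (by omega) (by omega)
              (by
                intro x hx1 hx2
                rw [hb, hb]
                rcases Nat.lt_or_ge p x with hpx | hpx
                · rcases Nat.lt_or_ge x e with hxe | hxe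
                  · have := hlt x hpx hxe
                    split_ifs <;> omega
                  · have : x = e := by omega
                    subst this
                    split_ifs <;> omega
                · have : x = p := by omega
                  subst this; exact le_rfl)
            have h1 := hdom D (by omega) (by omega)
            have h2 := hDlt p (by omega) hpD
            omega
          subst hp0
          refine ⟨0, e + 1, by omega, Or.inl rfl, ?_, ?_⟩
          · intro x hx1 hx2
            rw [hat_le_hi (x := e + 1) (by omega) (by omega)]
            simp only [Nat.add_sub_cancel]
            rcases Nat.lt_or_ge D x with hx | hx
            · rw [hat_le_hi (by omega) hx]
              have := hlt (x - 1) (by omega) (by omega)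
              omega
            · rw [hat_le_lo (by omega) hx]
              rcases Nat.lt_or_ge x e with hxe | hxe
              · have := hlt x (by omega) (by omega)
                omega
              · have : x = e := by omega
                subst this; omega
          · intro x
            rcases Nat.lt_or_ge D x with hx | hx
            · rw [hat_le_hi (by omega) hx, hat_le_hi (by omega) hx, hb]
              split_ifs <;> omega
            · rw [hat_le_lo (by omega) hx, hat_le_lo (by omega) hx, hb]
              split_ifs <;> omega
        · refine ⟨p + 1, e + 1, by omega, Or.inr ?_, ?_, ?_⟩
          · rw [hat_le_hi (by omega) (by omega), hat_le_hi (by omega) (by omega)]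
            simp only [Nat.add_sub_cancel]
            omega
          · intro x hx1 hx2
            rw [hat_le_hi (by omega) (by omega), hat_le_hi (by omega) (by omega)]
            simp only [Nat.add_sub_cancel]
            have := hlt (x - 1) (by omega) (by omega)
            omega
          · intro x
            rcases Nat.lt_or_ge D x with hx | hx
            · rw [hat_le_hi (by omega) hx, hat_le_hi (by omega) hx, hb]
              split_ifs <;> omega
            · rw [hat_le_lo (by omega) hx, hat_le_lo (by omega) hx, hb]
              split_ifs <;> omega
    · subst hsr
      refine ⟨0, D, by omega, Or.inl rfl, ?_, ?_⟩
      · intro x hx1 hx2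
        rw [hat_le_lo (by omega) (by omega), hat_le_lo (by omega) (by omega)]
        have := hDlt x (by omega) hx2
        omega
      · intro x
        rcases Nat.lt_or_ge D x with hx | hx
        · rw [hat_le_hi le_rfl hx, hat_gt_hi (by omega) hx, if_neg (by omega)]
          simp
        · rw [hat_le_lo le_rfl hx]
          rcases Nat.eq_zero_or_pos x with hx0 | hx0
          · subst hx0
            rw [hat_gt_zero (by omega), if_neg (by omega), h.row0]
          · rw [hat_gt_lo (by omega) (by omega) hx, if_pos (by omega)]
            simp
    · obtain ⟨s, rfl⟩ : ∃ t, s = t + 1 := ⟨s - 1, by omega⟩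
      obtain ⟨p, e, hpe, hp, hlt, hb, hen, hef⟩ := h.step_data (show s < l by omega)
      have hDs := h.mono (show r ≤ s by omega) D
      have hor : e < D ∨ D ≤ p := by
        by_contra hc
        rcases Nat.lt_or_ge D e with hxe | hxe
        · have := hlt D (by omega) hxe
          omega
        · have : D = e := by omega
          subst this; omega
      have hv0 : ∀ t, r < t → hat r D A t 0 = 0 := fun t ht => hat_gt_zero ht
      have hv1 : ∀ t x, r < t → 1 ≤ x → x ≤ D → hat r D A t x = A (t - 1) x + 1 :=
        fun t x ht hx hx' => hat_gt_lo ht hx hx'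
      have hv2 : ∀ t x, r < t → D < x → hat r D A t x = A (t - 1) (x - 1) + 1 :=
        fun t x ht hx => hat_gt_hi ht hx
      have hval : ∀ x, hat r D A (s + 1 + 1) x = 
          if x = 0 then 0 else if x ≤ D then A (s + 1) x + 1 else A (s + 1) (x - 1) + 1 := by
        intro x
        simp [hat, show ¬ s + 1 + 1 ≤ r by omega]
      have hval' : ∀ x, hat r D A (s + 1) x = 
          if x = 0 then 0 else if x ≤ D then A s x + 1 else A s (x - 1) + 1 := by
        intro x
        simp [hat, show ¬ s + 1 ≤ r by omega]
      rcases hor with he | hpD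
      · refine ⟨p, e, hpe, ?_, ?_, ?_⟩
        · rw [hval', hval']
          split_ifs <;> omega
        · intro x hx1 hx2
          have := hlt x hx1 hx2
          rw [hval', hval']
          split_ifs <;> omega
        · intro x
          rw [hval', hval, hb, hb]
          split_ifs <;> omega
      · refine ⟨p + 1, e + 1, by omega, Or.inr ?_, ?_, ?_⟩
        · rw [hval', hval', if_neg (by omega), if_neg (by omega), if_neg (by omega),
            if_neg (by omega), Nat.add_sub_cancel, Nat.add_sub_cancel]
          omega
        · intro x hx1 hx2
          have := hlt (x - 1) (by omega) (by omega)
          rw [hval', hval', if_neg (by omega), if_neg (by omega), if_neg (by omega),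
            if_neg (by omega), Nat.add_sub_cancel]
          omega
        · intro x
          rw [hval', hval, hb, hb]
          split_ifs <;> omega
  · intro s hs x
    rcases Nat.eq_zero_or_pos x with hx0 | hx0
    · subst hx0
      rw [hat_gt_zero (by omega)]; simp
    · rcases Nat.lt_or_ge D x with hx | hx
      · rw [hat_gt_hi (by omega) hx, h.fin _ (by omega)]
        split_ifs <;> omega
      · rw [hat_gt_lo (by omega) hx0 hx, h.fin _ (by omega)]
        split_ifs <;> omega

theorem hat_isD {n l r D A} (hn : 1 ≤ n) (h : Ch n l A) (hD : IsD A n r D)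
    {s k : ℕ} (hs : s ≤ r) (hk : IsD A n s k) : IsD (hat r D A) (n + 1) s (k + 1) := by
  have hDn := h.isD_le hn hD
  have hDk : D ≤ k := by
    by_contra hc
    have h1 := hD.2.2 k hk.1 (by omega)
    have h2 := h.mono hs k
    have := hk.2.1
    omega
  refine ⟨by omega, ?_, ?_⟩
  · rw [hat_le_hi hs (by omega)]
    have := hk.2.1
    simp only [Nat.add_sub_cancel]; omega
  · intro x hx1 hx2
    rcases Nat.lt_or_ge D x with hx | hx
    · rw [hat_le_hi hs hx]
      have := hk.2.2 (x - 1) (by have := hD.1; omega) (by omega)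
      omega
    · rw [hat_le_lo hs hx]
      have := h.le s x
      omega

theorem hat_plus_lt {n l r D A} (hn : 1 ≤ n) (h : Ch n l A) (hD : IsD A n r D)
    {s : ℕ} (hs : s < r) : Plus (hat r D A) (n + 1) s ↔ Plus A n s := by
  obtain ⟨k, hk⟩ := h.exists_isD hn s
  obtain ⟨k', hk'⟩ := h.exists_isD hn (s + 1)
  have h1 := hat_isD hn h hD hs.le hk
  have h2 := hat_isD hn h hD hs hk'
  constructor
  · rintro ⟨j, hj, hj'⟩
    have e1 := hj.unique h1
    have e2 := hj'.unique h2
    refine ⟨k', ?_, hk'⟩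
    have : k' + 1 = k := by omega
    rw [this]; exact hk
  · rintro ⟨j, hj, hj'⟩
    have e1 := hj.unique hk
    have e2 := hj'.unique hk'
    refine ⟨k' + 1, ?_, h2⟩
    have : k' + 1 + 1 = k + 1 := by omega
    rw [this]; exact h1

theorem hat_isD_succ {n r D A} (hD : IsD A n r D) :
    IsD (hat r D A) (n + 1) (r + 1) D := by
  refine ⟨hD.1, ?_, ?_⟩
  · rw [hat_gt_lo (by omega) hD.1 le_rfl]
    have := hD.2.1
    simp only [Nat.add_sub_cancel]; omega
  · intro x hx1 hx2
    rw [hat_gt_lo (by omega) hx1 hx2.le]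
    have := hD.2.2 x hx1 hx2
    simp only [Nat.add_sub_cancel]; omega

theorem hat_inj {n l n' l' r D A B} (h : Ch n l A) (h' : Ch n' l' B)
    (heq : hat r D A = hat r D B) : A = B := by
  funext s x
  rcases Nat.lt_or_ge r s with hs | hs
  · rcases Nat.eq_zero_or_pos x with hx0 | hx0
    · subst hx0
      rw [h.row0, h'.row0]
    · rcases Nat.lt_or_ge D x with hx | hx
      · have := congrFun (congrFun heq (s + 1)) (x + 1)
        rw [hat_gt_hi (by omega) (by omega), hat_gt_hi (by omega) (by omega)] at this
        simpa using this
      · have := congrFun (congrFun heq (s + 1)) x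
        rw [hat_gt_lo (by omega) hx0 hx, hat_gt_lo (by omega) hx0 hx] at this
        simpa using this
  · rcases Nat.lt_or_ge D x with hx | hx
    · have := congrFun (congrFun heq s) (x + 1)
      rw [hat_le_hi (by omega) (by omega), hat_le_hi (by omega) (by omega)] at this
      simpa using this
    · have := congrFun (congrFun heq s) x
      rwa [hat_le_lo hs hx, hat_le_lo hs hx] at this

/-- The step at a plus-full-set is the full strip. -/
theorem Ch.plus_step {n l r D B} (hn : 1 ≤ n) (h : Ch n l B) (hr : r < l)
    (h1 : IsD B n r (D + 1)) (h2 : IsD B n (r + 1) D) :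
    (∀ x, B (r + 1) x = if 1 ≤ x ∧ x ≤ D then B r x + 1 else B r x) ∧
    (∀ x, 1 ≤ x → x < D → B r x < B r D) ∧ B r D + 1 = n := by
  obtain ⟨p, e, hpe, hp, hlt, hb, hen, hef⟩ := h.step_data hr
  have hDn := h.isD_le hn h1
  have a1 := h1.2.2 D h2.1 (by omega)
  have a2 := h2.2.1
  have a3 := hb D
  have hin : p < D ∧ D ≤ e := by
    by_contra hc
    rw [if_neg hc] at a3
    omega
  rw [if_pos hin] at a3
  have he : e = D := by
    by_contra hc
    have := hlt D hin.1 (by omega)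
    omega
  subst he
  have hp0 : p = 0 := by
    by_contra hc
    have := h1.2.2 p (by omega) (by omega)
    omega
  subst hp0
  exact ⟨hb, fun x hx1 hx2 => hlt x (by omega) hx2, by omega⟩

theorem unhat_le {r D B s x} (hs : s ≤ r) :
    unhat r D B s x = if x ≤ D then B s x else B s (x + 1) - 1 := by
  simp [unhat, hs]

theorem unhat_ch {n l r D B} (hn : 1 ≤ n) (h : Ch (n + 1) (l + 1) B) (hr : r ≤ l)
    (h1 : IsD B (n + 1) r (D + 1)) (h2 : IsD B (n + 1) (r + 1) D) :
    Ch n l (unhat r D B) ∧ hat r D (unhat r D B) = B ∧ IsD (unhat r D B) n r D := by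
  obtain ⟨hQ, hQlt, hQD⟩ := h.plus_step (by omega) (by omega) h1 h2
  have hDn := h.isD_le (by omega) h1
  have hD1 := h2.1
  have hR : ∀ s, s ≤ r → B s (D + 1) = B s D + 1 := by
    intro s hs
    have a1 := h.anti s D hD1
    by_contra hc
    have a2 := h.dom (s := s) (s' := r) (p := D) (q := D + 1) hD1 hs (by
      intro x hx1 hx2
      rcases Nat.lt_or_ge D x with hx | hx
      · have : x = D + 1 := by omega
        subst this; omega
      · have : x = D := by omega
        subst this; omega) (D + 1) (by omega) le_rfl
    have := h1.2.1
    omega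
  have hS : ∀ s, r < s → B s D = n + 1 ∧ B s (D + 1) = n + 1 := by
    intro s hs
    have a1 := h.mono (show r + 1 ≤ s by omega) D
    have a2 := h.mono (show r + 1 ≤ s by omega) (D + 1)
    have a3 := h.le s D
    have a4 := h.le s (D + 1)
    have a5 := h2.2.1
    have a6 := h1.2.1
    have a7 := h.mono_succ r (D + 1)
    omega
  have hval : ∀ s x, r ≤ s → unhat r D B s x =
      if x = 0 then 0 else if x ≤ D then B (s + 1) x - 1 else B (s + 1) (x + 1) - 1 := by
    intro s x hs
    rcases Nat.lt_or_ge r s with hs' | hs'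
    · simp [unhat, Nat.not_le.2 hs']
    · have : s = r := by omega
      subst this
      rw [unhat_le le_rfl, hQ, hQ]
      have := h.row0 s
      rcases Nat.eq_zero_or_pos x with hx0 | hx0
      · subst hx0; simp [this]
      · split_ifs <;> omega
  have hdom : ∀ s, s ≤ r → ∀ x, 1 ≤ x → x < D → ∃ y, x < y ∧ y ≤ D ∧ B s x < B s y := by
    intro s hs x hx1 hx2
    by_contra hc
    push Not at hc
    have := h.dom (s := s) (s' := r) (p := x) (q := D) hx1 hs (by
      intro y hy1 hy2
      rcases Nat.lt_or_ge x y with hy | hy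
      · exact hc y hy hy2
      · have : x = y := by omega
        subst this; exact le_rfl) D hx2.le le_rfl
    have := hQlt x hx1 hx2
    omega
  refine ⟨⟨?_, ?_, ?_⟩, ?_, ?_⟩
  · intro x
    rw [unhat_le (Nat.zero_le _), h.zero, h.zero]
    split_ifs <;> omega
  · intro s hs
    rcases Nat.lt_or_ge s r with hsr | hsr
    · obtain ⟨p, e, hpe, hp, hlt, hb, hen, hef⟩ := h.step_data (show s < l + 1 by omega)
      have r1 := hR s hsr.le
      have r2 := hR (s + 1) hsr
      have heD : e ≠ D := by
        intro hc
        rw [hb, hb, if_neg (by omega), if_pos (by omega)] at r2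
        omega
      have hpD : p ≠ D := by
        intro hc
        rw [hb, hb, if_pos (by omega), if_neg (by omega)] at r2
        omega
      have hge := h.ge s
      rcases Nat.lt_or_ge e D with he | he
      · refine ⟨p, e, hpe, ?_, ?_, ?_⟩
        · rw [unhat_le hsr.le, unhat_le hsr.le, if_pos (by omega), if_pos (by omega)]
          exact hp
        · intro x hx1 hx2
          rw [unhat_le hsr.le, unhat_le hsr.le, if_pos (by omega), if_pos (by omega)]
          exact hlt x hx1 hx2
        · intro x
          rw [unhat_le hsr.le, unhat_le hsr, hb, hb]
          split_ifs <;> omega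
      · obtain ⟨e, rfl⟩ : ∃ e', e = e' + 1 := ⟨e - 1, by omega⟩
        rcases Nat.lt_or_ge p D with hpD' | hpD'
        · refine ⟨p, e, by omega, ?_, ?_, ?_⟩
          · have := hge (e + 1)
            rw [unhat_le hsr.le, unhat_le hsr.le, if_pos (show p ≤ D by omega)]
            split_ifs with hh
            · have : e = D := by omega
              subst this; omega
            · omega
          · intro x hx1 hx2
            have hxx : B s x + 1 < B s (e + 1) ∨ D < x := by
              rcases lt_trichotomy x D with hxD | hxD | hxD
              · left
                obtain ⟨y, hy1, hy2, hy3⟩ := hdom s hsr.le x (by omega) hxD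
                have := hlt y (by omega) (by omega)
                omega
              · left
                subst hxD
                have := hlt (x + 1) (by omega) (by omega)
                omega
              · exact Or.inr hxD
            rw [unhat_le hsr.le, unhat_le hsr.le]
            have hx3 := hlt (x + 1) (by omega) (by omega)
            have hx4 := hge (x + 1)
            have hx5 : e ≤ D → B s e + 1 = B s (e + 1) := by
              intro hh
              have : e = D := by omega
              subst this; omega
            split_ifs with h5 h6 h7 <;> omega
          · intro x
            have := hge (x + 1)
            rw [unhat_le hsr.le, unhat_le hsr, hb, hb]
            split_ifs <;> omega
        · obtain ⟨p, rfl⟩ : ∃ p', p = p' + 1 := ⟨p - 1, by omega⟩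
          have := hge (e + 1)
          refine ⟨p, e, by omega, Or.inr ?_, ?_, ?_⟩
          · rw [unhat_le hsr.le, unhat_le hsr.le]
            have : p = D → B s D + 1 = B s (p + 1) := by rintro rfl; omega
            have : p ≤ D → p = D := by omega
            split_ifs with h5 h6 h7
            · omega
            · omega
            · have : p = D := by omega
              subst this; omega
            · omega
          · intro x hx1 hx2
            have := hlt (x + 1) (by omega) (by omega)
            have := hge (x + 1)
            rw [unhat_le hsr.le, unhat_le hsr.le, if_neg (by omega), if_neg (by omega)]
            omega
          · intro x
            have := hge (x + 1)
            rw [unhat_le hsr.le, unhat_le hsr, hb, hb]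
            split_ifs <;> omega
    · obtain ⟨p, e, hpe, hp, hlt, hb, hen, hef⟩ := h.step_data (show s + 1 < l + 1 by omega)
      have s1 := hS (s + 1) (by omega)
      have s2 := hS (s + 1 + 1) (by omega)
      have n1 : ¬ (p < D ∧ D ≤ e) := by
        intro hc
        have := hb D
        rw [if_pos hc] at this
        omega
      have n2 : ¬ (p < D + 1 ∧ D + 1 ≤ e) := by
        intro hc
        have := hb (D + 1)
        rw [if_pos hc] at this
        omega
      have hge := h.ge (s + 1)
      rcases Nat.lt_or_ge e D with he | he
      · refine ⟨p, e, hpe, ?_, ?_, ?_⟩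
        · have := hge e
          rw [hval _ _ hsr, hval _ _ hsr]
          split_ifs <;> omega
        · intro x hx1 hx2
          have := hge e
          have := hge x
          have := hlt x hx1 hx2
          rw [hval _ _ hsr, hval _ _ hsr]
          split_ifs <;> omega
        · intro x
          have := hge x
          rw [hval _ _ hsr, hval _ _ (by omega), hb, hb]
          split_ifs <;> omega
      · obtain ⟨p, rfl⟩ : ∃ p', p = p' + 1 := ⟨p - 1, by omega⟩
        obtain ⟨e, rfl⟩ : ∃ e', e = e' + 1 := ⟨e - 1, by omega⟩
        have := hge (e + 1)
        refine ⟨p, e, by omega, Or.inr ?_, ?_, ?_⟩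
        · rw [hval _ _ hsr, hval _ _ hsr]
          have hp5 : p ≤ D → B (s + 1) p = B (s + 1) (p + 1) := by
            intro hh
            have : p = D := by omega
            subst this; omega
          rw [if_neg (by omega), if_neg (by omega), if_neg (by omega)]
          split_ifs <;> omega
        · intro x hx1 hx2
          have := hge (x + 1)
          have := hlt (x + 1) (by omega) (by omega)
          rw [hval _ _ hsr, hval _ _ hsr]
          split_ifs <;> omega
        · intro x
          have := hge (x + 1)
          rw [hval _ _ hsr, hval _ _ (by omega), hb, hb]
          split_ifs <;> omega
  · intro s hs x
    rw [hval _ _ (by omega), h.fin _ (by omega), h.fin _ (by omega)]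
    rcases Nat.eq_zero_or_pos x with hx0 | hx0
    · simp [hx0]
    · have hx1 : x ≠ 0 := by omega
      simp only [hx1, if_false, Nat.succ_ne_zero]
      split_ifs <;> omega
  · funext s x
    have hge := h.ge s x
    rcases Nat.lt_or_ge r s with hs | hs
    · obtain ⟨s, rfl⟩ : ∃ t, s = t + 1 := ⟨s - 1, by omega⟩
      have s1 := hS (s + 1) hs
      rcases Nat.eq_zero_or_pos x with hx0 | hx0
      · subst hx0
        rw [hat_gt_zero hs, h.row0]
      · rcases Nat.lt_or_ge D x with hx | hx
        · obtain ⟨x, rfl⟩ : ∃ t, x = t + 1 := ⟨x - 1, by omega⟩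
          rw [hat_gt_hi hs hx, Nat.add_sub_cancel, Nat.add_sub_cancel, hval _ _ (by omega)]
          split_ifs with a1 a2
          · omega
          · have : x = D := by omega
            subst this; omega
          · omega
        · rw [hat_gt_lo hs hx0 hx, Nat.add_sub_cancel, hval _ _ (by omega)]
          split_ifs <;> omega
    · rcases Nat.lt_or_ge D x with hx | hx
      · obtain ⟨x, rfl⟩ : ∃ t, x = t + 1 := ⟨x - 1, by omega⟩
        rw [hat_le_hi hs hx, Nat.add_sub_cancel, unhat_le hs]
        split_ifs with a1
        · have : x = D := by omega
          subst this
          exact (hR s hs).symm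
        · omega
      · rw [hat_le_lo hs hx, unhat_le hs, if_pos hx]
  · refine ⟨hD1, ?_, ?_⟩
    · rw [unhat_le le_rfl, if_pos le_rfl]; omega
    · intro x hx1 hx2
      rw [unhat_le le_rfl, if_pos hx2.le]
      have := hQlt x hx1 hx2
      omega


theorem Ch.finite (n l : ℕ) : {A | Ch n l A}.Finite := by
  let g : (ℕ → ℕ → ℕ) → (Fin (l + 1) → Fin (n + 1) → Fin (n + 1)) :=
    fun A s x => Fin.ofNat (n + 1) (A s x)
  apply Set.Finite.of_finite_image (f := g) (Set.toFinite _)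
  intro A hA B hB hAB
  have hA : Ch n l A := hA
  have hB : Ch n l B := hB
  funext s x
  rcases Nat.lt_or_ge l s with hs | hs
  · rw [hA.fin s hs.le, hB.fin s hs.le]
  · have a1 := hA.le s x
    have a2 := hB.le s x
    have a3 := hA.ge s x
    have a4 := hB.ge s x
    rcases Nat.lt_or_ge n x with hx | hx
    · omega
    · have := congrArg Fin.val (congrFun (congrFun hAB ⟨s, by omega⟩) ⟨x, by omega⟩)
      simp only [g, Fin.ofNat] at this
      rw [Nat.mod_eq_of_lt (by omega), Nat.mod_eq_of_lt (by omega)] at this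
      exact this

/-- Chains without plus-full-sets among the labels `1, …, r`. -/
def G (n l r : ℕ) : Set (ℕ → ℕ → ℕ) := {A | Ch n l A ∧ ∀ s, s < r → ¬ Plus A n s}

theorem G_finite (n l r : ℕ) : (G n l r).Finite :=
  (Ch.finite n l).subset fun _ h => h.1

/-- Chains whose first plus-full-set is the `(r + 1)`-set. -/
def H (n l r : ℕ) : Set (ℕ → ℕ → ℕ) :=
  {A | Ch n l A ∧ (∀ s, s < r → ¬ Plus A n s) ∧ Plus A n r}

theorem H_ncard {n l r : ℕ} (hn : 1 ≤ n) (hr : r ≤ l) :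
    (H (n + 1) (l + 1) r).ncard = (G n l r).ncard := by
  classical
  have hex : ∀ A, ∃ D, A ∈ G n l r → IsD A n r D := by
    intro A
    by_cases hA : A ∈ G n l r
    · obtain ⟨D, hD⟩ := hA.1.exists_isD hn r
      exact ⟨D, fun _ => hD⟩
    · exact ⟨0, fun h => absurd h hA⟩
  choose dd hdd using hex
  have himg : (fun A => hat r (dd A) A) '' G n l r = H (n + 1) (l + 1) r := by
    apply Set.Subset.antisymm
    · rintro _ ⟨A, hA, rfl⟩
      have hD := hdd A hA
      refine ⟨hat_ch hn hA.1 hr hD, ?_, ?_⟩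
      · intro s hs
        rw [hat_plus_lt hn hA.1 hD hs]
        exact hA.2 s hs
      · exact ⟨dd A, hat_isD hn hA.1 hD le_rfl hD, hat_isD_succ hD⟩
    · rintro B ⟨hB, hB1, D, h1, h2⟩
      obtain ⟨hc, he, hD⟩ := unhat_ch hn hB hr h1 h2
      have hmem : unhat r D B ∈ G n l r := by
        refine ⟨hc, fun s hs => ?_⟩
        rw [← hat_plus_lt hn hc hD hs, he]
        exact hB1 s hs
      refine ⟨unhat r D B, hmem, ?_⟩
      have : dd (unhat r D B) = D := (hdd _ hmem).unique hD
      simp only [this, he]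
  rw [← himg]
  apply Set.InjOn.ncard_image
  intro A hA B hB hAB
  simp only at hAB
  have h1 := hat_isD_succ (hdd A hA)
  have h2 := hat_isD_succ (hdd B hB)
  rw [hAB] at h1
  have := h1.unique h2
  rw [this] at hAB
  exact hat_inj hA.1 hB.1 hAB

theorem G_succ (n l r : ℕ) : (G n l r).ncard = (G n l (r + 1)).ncard + (H n l r).ncard := by
  have hu : G n l r = G n l (r + 1) ∪ H n l r := by
    ext A
    constructor
    · intro hA
      by_cases hp : Plus A n r
      · exact Or.inr ⟨hA.1, hA.2, hp⟩
      · refine Or.inl ⟨hA.1, fun s hs => ?_⟩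
        rcases Nat.lt_or_ge s r with h | h
        · exact hA.2 s h
        · have : s = r := by omega
          rwa [this]
    · rintro (hA | hA)
      · exact ⟨hA.1, fun s hs => hA.2 s (by omega)⟩
      · exact ⟨hA.1, hA.2.1⟩
  have hd : Disjoint (G n l (r + 1)) (H n l r) := by
    rw [Set.disjoint_left]
    intro A hA hB
    exact hA.2 r (by omega) hB.2.2
  have hf : (H n l r).Finite := (Ch.finite n l).subset fun _ h => h.1
  rw [hu, Set.ncard_union_eq hd (G_finite _ _ _) hf]

theorem G_rec {n l r : ℕ} (hn : 1 ≤ n) (hr : r ≤ l) :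
    (G (n + 1) (l + 1) r).ncard = (G (n + 1) (l + 1) (r + 1)).ncard + (G n l r).ncard := by
  rw [G_succ, H_ncard hn hr]

theorem G_one {l r : ℕ} : G 1 l r = {A | Ch 1 l A} := by
  ext A
  refine ⟨fun h => h.1, fun h => ⟨h, ?_⟩⟩
  rintro s hs ⟨k, h1, h2⟩
  have a1 := Ch.isD_le h le_rfl h1
  have := h2.1
  omega

theorem G_zero {n l : ℕ} : G n l 0 = {A | Ch n l A} := by
  ext A
  exact ⟨fun h => h.1, fun h => ⟨h, fun s hs => by omega⟩⟩

theorem Ch.no_plus_ge {n l A} (h : Ch n l A) {s : ℕ} (hs : l ≤ s) : ¬ Plus A n s := by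
  rintro ⟨k, h1, h2⟩
  have a1 := h1.2.2 k h2.1 (by omega)
  have a2 := h2.2.1
  rw [h.fin _ (by omega)] at a2
  rw [h.fin _ (by omega)] at a1
  omega

theorem G_full {n l : ℕ} : G n l l = {A | Ch n l A ∧ ∀ s, ¬ Plus A n s} := by
  ext A
  refine ⟨fun h => ⟨h.1, fun s => ?_⟩, fun h => ⟨h.1, fun s _ => h.2 s⟩⟩
  rcases Nat.lt_or_ge s l with hs | hs
  · exact h.2 s hs
  · exact h.1.no_plus_ge hs

theorem G_formula (m k : ℕ) : ∀ r, r ≤ k + m → (G (k + 1) (k + m) r).ncard =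
    ∑ t ∈ Finset.range (k + 1), Nat.choose (k + m - r) (k - t) *
      (G (t + 1) (t + m) (t + m)).ncard := by
  induction k with
  | zero =>
    intro r hr
    simp [G_one]
  | succ k ih =>
    intro r hr
    -- downward induction on `r`
    obtain ⟨j, hj⟩ : ∃ j, j = k + 1 + m - r := ⟨_, rfl⟩
    induction j generalizing r with
    | zero =>
      have : r = k + 1 + m := by omega
      subst this
      rw [Finset.sum_range_succ, Finset.sum_eq_zero]
      · simp
      · intro t ht
        have := Finset.mem_range.1 ht
        rw [Nat.sub_self, Nat.choose_eq_zero_of_lt (by omega), zero_mul]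
    | succ j ihj =>
      have e1 : k + 1 + m = (k + m) + 1 := by ring
      have hrec := G_rec (n := k + 1) (l := k + m) (r := r) (by omega) (by omega)
      rw [e1, hrec, ← e1, ihj (r + 1) (by omega) (by omega), ih r (by omega),
        Finset.sum_range_succ, Finset.sum_range_succ _ (k + 1)]
      have e2 : k + m + 1 - r = (k + m - r) + 1 := by omega
      have e3 : k + 1 + m - (r + 1) = k + m - r := by omega
      rw [e1, e2]
      have e4 : k + m + 1 - (r + 1) = k + m - r := by omega
      rw [e4]
      simp only [Nat.sub_self, Nat.choose_zero_right]
      rw [add_right_comm, ← Finset.sum_add_distrib]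
      congr 1
      apply Finset.sum_congr rfl
      intro t ht
      have ht := Finset.mem_range.1 ht
      have e5 : k + 1 - t = (k - t) + 1 := by omega
      rw [e5, Nat.choose_succ_succ]
      ring

theorem G_inverse (m r : ℕ) : ∀ k, r ≤ k + m → ((G (k + 1) (k + m) r).ncard : ℤ) =
    ∑ t ∈ Finset.range (k + 1), (-1 : ℤ) ^ (k - t) * (Nat.choose r (k - t) : ℤ) *
      ((G (t + 1) (t + m) 0).ncard : ℤ) := by
  induction r with
  | zero =>
    intro k hk
    rw [Finset.sum_range_succ, Finset.sum_eq_zero]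
    · simp
    · intro t ht
      have := Finset.mem_range.1 ht
      rw [Nat.choose_eq_zero_of_lt (by omega)]
      simp
  | succ r ih =>
    intro k hk
    cases k with
    | zero => simp [G_one]
    | succ k =>
      have e1 : k + 1 + m = (k + m) + 1 := by ring
      have hrec := G_rec (n := k + 1) (l := k + m) (r := r) (by omega) (by omega)
      have h1 := ih (k + 1) (by omega)
      have h2 := ih k (by omega)
      rw [e1] at h1 ⊢
      have h3 : ((G (k + 1 + 1) (k + m + 1) (r + 1)).ncard : ℤ) =
        ((G (k + 1 + 1) (k + m + 1) r).ncard : ℤ) - ((G (k + 1) (k + m) r).ncard : ℤ) := by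
        rw [hrec]; push_cast; ring
      rw [h3, h1, h2, Finset.sum_range_succ, Finset.sum_range_succ _ (k + 1)]
      simp only [Nat.sub_self, Nat.choose_zero_right]
      rw [add_sub_right_comm, ← Finset.sum_sub_distrib]
      congr 1
      apply Finset.sum_congr rfl
      intro t ht
      have ht := Finset.mem_range.1 ht
      have e5 : k + 1 - t = (k - t) + 1 := by omega
      rw [e5, Nat.choose_succ_succ]
      push_cast
      ring

/-- No chains without plus-full-sets for large `n`. -/
theorem noplus_bound {n l A} (hn : 1 ≤ n) (h : Ch n l A) (hp : ∀ s, ¬ Plus A n s) :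
    3 * n ≤ 2 * l + 3 := by
  have key : ∀ s, s ≤ l → ∀ D, IsD A n s D →
      2 * ((Finset.Icc 1 n).filter (fun x => A s x = n)).card + 2 * A s 1 + D ≤
        n + 2 * s + 4 := by
    intro s
    induction s with
    | zero =>
      intro _ D hD
      have h1 : ((Finset.Icc 1 n).filter (fun x => A 0 x = n)).card ≤ 1 := by
        rw [Finset.card_le_one]
        intro a ha b hb
        simp only [Finset.mem_filter, h.zero] at ha hb
        omega
      have h2 := h.isD_le hn hD
      have h3 := h.zero 1
      omega
    | succ s ih =>
      intro hs D' hD'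
      obtain ⟨D, hD⟩ := h.exists_isD hn s
      have ih' := ih (by omega) D hD
      obtain ⟨p, e, hpe, hp', hlt, hb, hen, hef⟩ := h.step_data (show s < l by omega)
      have hDD : D' ≤ D := by
        by_contra hc
        have a1 := hD'.2.2 D hD.1 (by omega)
        have a2 := h.mono_succ s D
        have a3 := hD.2.1
        omega
      have hb1 := hb 1
      have hin : ∀ x, p < x → x ≤ e → A s x ≤ A s e := by
        intro x hx1 hx2
        rcases Nat.lt_or_ge x e with h | h
        · exact (hlt x hx1 h).le
        · have : x = e := by omega
          rw [this]
      by_cases hfull : A s e + 1 = n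
      · have hc : ((Finset.Icc 1 n).filter (fun x => A (s + 1) x = n)).card ≤
            ((Finset.Icc 1 n).filter (fun x => A s x = n)).card + 1 := by
          refine le_trans (Finset.card_le_card (t := insert e
            ((Finset.Icc 1 n).filter (fun x => A s x = n))) ?_) (Finset.card_insert_le _ _)
          intro x hx
          simp only [Finset.mem_filter, Finset.mem_insert] at hx ⊢
          rw [hb] at hx
          by_cases hxe : x = e
          · exact Or.inl hxe
          · refine Or.inr ⟨hx.1, ?_⟩
            have h2 := hx.2
            split_ifs at h2 with hc
            · have := hlt x hc.1 (by omega)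
              omega
            · exact h2
        by_cases hp0 : p = 0
        · subst hp0
          rw [if_pos (by omega)] at hb1
          have hDe : IsD A n (s + 1) e := by
            refine ⟨by omega, ?_, ?_⟩
            · rw [hb, if_pos (by omega)]; omega
            · intro x hx1 hx2
              rw [hb, if_pos (by omega)]
              have := hlt x (by omega) hx2
              omega
          have heD := hD'.unique hDe
          subst heD
          have a1 : D' ≠ D := by
            intro hc
            have := hD.2.1
            rw [← hc] at this
            omega
          have a2 : D ≠ D' + 1 := by
            intro hc
            rw [hc] at hD
            exact hp s ⟨D', hD, hD'⟩
          omega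
        · rw [if_neg (by omega)] at hb1
          omega
      · have hc : ((Finset.Icc 1 n).filter (fun x => A (s + 1) x = n)).card ≤
            ((Finset.Icc 1 n).filter (fun x => A s x = n)).card := by
          refine Finset.card_le_card ?_
          intro x hx
          simp only [Finset.mem_filter] at hx ⊢
          refine ⟨hx.1, ?_⟩
          have h2 := hx.2
          rw [hb] at h2
          split_ifs at h2 with hc
          · have := hin x hc.1 hc.2
            omega
          · exact h2
        split_ifs at hb1 <;> omega
  have hD : IsD A n l 1 := by
    refine ⟨le_rfl, ?_, fun x hx1 hx2 => by omega⟩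
    rw [h.fin l le_rfl]; simp
  have h1 := key l le_rfl 1 hD
  have h2 : (Finset.Icc 1 n).filter (fun x => A l x = n) = Finset.Icc 1 n := by
    apply Finset.filter_true_of_mem
    intro x hx
    have := Finset.mem_Icc.1 hx
    rw [h.fin l le_rfl, if_neg (by omega)]
    omega
  rw [h2, Nat.card_Icc, h.fin l le_rfl 1] at h1
  simp only [one_ne_zero, if_false] at h1
  omega

/-- The extremal chain. -/
def ext0 (m : ℕ) : ℕ → ℕ → ℕ := fun t x =>
  if x = 0 then 0
  else if x + 1 ≤ 2 * (m - t / 3) then x + 2 * (t / 3) + t % 3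
  else if x ≤ 2 * (m - t / 3) then x + 2 * (t / 3)
  else max x (2 * m + 1)

theorem ext0_ch (m : ℕ) : Ch (2 * m + 1) (3 * m) (ext0 m) := by
  refine ⟨?_, ?_, ?_⟩
  · intro x
    simp only [ext0]
    split_ifs <;> first | omega | contradiction
  · intro t ht
    obtain ⟨s, hs⟩ : ∃ s, s = t / 3 := ⟨_, rfl⟩
    obtain ⟨j, hj⟩ : ∃ j, m = s + j + 1 := ⟨m - s - 1, by omega⟩
    have hc : t % 3 = 0 ∨ t % 3 = 1 ∨ t % 3 = 2 := by omega
    have hc' : t % 3 = 2 ∨ t % 3 < 2 := by omega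
    rcases hc' with hc | hc
    · have e1 : (t + 1) / 3 = s + 1 := by omega
      have e2 : (t + 1) % 3 = 0 := by omega
      refine ⟨2 * j + 1, 2 * j + 2, by omega, Or.inr ?_, fun x _ _ => by omega, ?_⟩
      · simp only [ext0, ← hs, hc]
        split_ifs <;> first | omega | contradiction
      · intro x
        simp only [ext0, ← hs, hc, e1, e2]
        split_ifs <;> first | omega | contradiction
    · have e1 : (t + 1) / 3 = s := by omega
      have e2 : (t + 1) % 3 = t % 3 + 1 := by omega
      refine ⟨0, 2 * j + 1, by omega, Or.inl rfl, fun x _ _ => ?_, ?_⟩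
      · simp only [ext0, ← hs]
        split_ifs <;> first | omega | contradiction
      · intro x
        simp only [ext0, ← hs, e1, e2]
        split_ifs <;> first | omega | contradiction
  · intro t ht x
    simp only [ext0]
    split_ifs <;> first | omega | contradiction

theorem ext0_noplus (m s : ℕ) : ¬ Plus (ext0 m) (2 * m + 1) s := by
  rcases Nat.lt_or_ge s (3 * m) with ht | ht
  · rintro ⟨k, h1, h2⟩
    obtain ⟨q, hq⟩ : ∃ q, q = s / 3 := ⟨_, rfl⟩
    obtain ⟨j, hj⟩ : ∃ j, m = q + j + 1 := ⟨m - q - 1, by omega⟩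
    have hc' : s % 3 = 2 ∨ s % 3 = 1 ∨ s % 3 = 0 := by omega
    have d1 : IsD (ext0 m) (2 * m + 1) s (if s % 3 = 2 then 2 * j + 1 else 2 * j + 3) := by
      refine ⟨by split_ifs <;> omega, ?_, ?_⟩
      · simp only [ext0, ← hq]
        split_ifs <;> first | omega | contradiction
      · intro x hx1 hx2
        simp only [ext0, ← hq]
        split_ifs at hx2 ⊢ <;> first | omega | contradiction
    have d2 : IsD (ext0 m) (2 * m + 1) (s + 1) (if s % 3 = 0 then 2 * j + 3 else 2 * j + 1) := by
      rcases hc' with hc | hc | hc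
      · have e1 : (s + 1) / 3 = q + 1 := by omega
        have e2 : (s + 1) % 3 = 0 := by omega
        refine ⟨by split_ifs <;> omega, ?_, ?_⟩
        · simp only [ext0, e1, e2]
          split_ifs <;> first | omega | contradiction
        · intro x hx1 hx2
          simp only [ext0, e1, e2]
          split_ifs at hx2 ⊢ <;> first | omega | contradiction
      all_goals
        have e1 : (s + 1) / 3 = q := by omega
        have e2 : (s + 1) % 3 = s % 3 + 1 := by omega
        refine ⟨by split_ifs <;> omega, ?_, ?_⟩
        · simp only [ext0, e1, e2]
          split_ifs <;> first | omega | contradiction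
        · intro x hx1 hx2
          simp only [ext0, e1, e2]
          split_ifs at hx2 ⊢ <;> first | omega | contradiction
    have u1 := h1.unique d1
    have u2 := h2.unique d2
    split_ifs at u1 u2 <;> first | omega | contradiction
  · exact (ext0_ch m).no_plus_ge ht

theorem G_pos (m : ℕ) : (G (2 * m + 1) (3 * m) (3 * m)).ncard ≠ 0 := by
  have hm : ext0 m ∈ G (2 * m + 1) (3 * m) (3 * m) :=
    ⟨ext0_ch m, fun s _ => ext0_noplus m s⟩
  intro h0
  rw [Set.ncard_eq_zero (G_finite _ _ _)] at h0
  rw [h0] at hm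
  exact hm

theorem G_vanish {m k : ℕ} (hk : 2 * m < k) : (G (k + 1) (k + m) (k + m)).ncard = 0 := by
  have : G (k + 1) (k + m) (k + m) = ∅ := by
    rw [Set.eq_empty_iff_forall_notMem]
    intro A hA
    rw [G_full] at hA
    have := (noplus_bound (by omega) hA.1 hA.2)
    omega
  rw [this, Set.ncard_empty]


/-! ### Transfer to `ψ`-tableaux -/

/-- The tableau of an abstract chain. -/
def Phi (l : ℕ) (A : ℕ → ℕ → ℕ) : ℕ × ℕ → ℕ := psiFun (fun s x => A s x - x) l

theorem phi_nobox {n l A} (h : Ch n l A) {x y : ℕ} (hb : ¬ (1 ≤ x ∧ 1 ≤ y ∧ x + y ≤ n)) :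
    Phi l A (x, y) = 0 := by
  unfold Phi psiFun
  rw [if_neg]
  simp only
  rw [h.fin l le_rfl]
  split_ifs <;> omega

theorem phi_le {n l A} (h : Ch n l A) {x y : ℕ} (hx : 1 ≤ x) (hy : 1 ≤ y) (hxy : x + y ≤ n)
    (r : ℕ) : Phi l A (x, y) ≤ r ↔ x + y ≤ A r x := by
  have hl : y ≤ A l x - x := by
    rw [h.fin l le_rfl, if_neg (by omega)]; omega
  unfold Phi psiFun
  rw [if_pos ⟨hx, hy, hl⟩]
  simp only
  have hne : {r | r ≤ l ∧ y ≤ A r x - x}.Nonempty := ⟨l, le_rfl, hl⟩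
  have hmem := Nat.sInf_mem hne
  constructor
  · intro hr
    have := h.mono hr x
    have := hmem.2
    omega
  · intro hr
    rcases Nat.lt_or_ge l r with hlr | hlr
    · exact hmem.1.trans hlr.le
    · exact Nat.sInf_le ⟨hlr, by omega⟩

theorem phi_eq_succ {n l A} (h : Ch n l A) {x y r : ℕ} :
    Phi l A (x, y) = r + 1 ↔
      1 ≤ x ∧ 1 ≤ y ∧ x + y ≤ n ∧ x + y ≤ A (r + 1) x ∧ A r x < x + y := by
  by_cases hb : 1 ≤ x ∧ 1 ≤ y ∧ x + y ≤ n
  · have h1 := phi_le h hb.1 hb.2.1 hb.2.2 r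
    have h2 := phi_le h hb.1 hb.2.1 hb.2.2 (r + 1)
    omega
  · rw [phi_nobox h hb]
    omega

theorem phi_ne_zero {n l A} (h : Ch n l A) {x y : ℕ} :
    Phi l A (x, y) ≠ 0 ↔ 1 ≤ x ∧ 1 ≤ y ∧ x + y ≤ n := by
  by_cases hb : 1 ≤ x ∧ 1 ≤ y ∧ x + y ≤ n
  · have h1 := phi_le h hb.1 hb.2.1 hb.2.2 0
    rw [h.zero] at h1
    simp only [hb, and_true, iff_true]
    omega
  · rw [phi_nobox h hb]
    simp only [hb]
    simp

theorem phi_le_l {n l A} (h : Ch n l A) (x y : ℕ) : Phi l A (x, y) ≤ l := by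
  by_cases hb : 1 ≤ x ∧ 1 ≤ y ∧ x + y ≤ n
  · rw [phi_le h hb.1 hb.2.1 hb.2.2, h.fin l le_rfl, if_neg (by omega)]
    omega
  · rw [phi_nobox h hb]; omega

theorem phi_exists {n l A} (h : Ch n l A) {r : ℕ} (hr : r < l) : ∃ b, Phi l A b = r + 1 := by
  obtain ⟨p, e, hpe, hp, hlt, hb, hen, hef⟩ := h.step_data hr
  refine ⟨(e, A r e + 1 - e), ?_⟩
  have h1 := h.ge r e
  have h2 := hb e
  rw [if_pos (by omega)] at h2
  rw [phi_eq_succ h]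
  omega

theorem sSup_Icc_one (a : ℕ) : sSup {y | 1 ≤ y ∧ y ≤ a} = a := by
  rcases Nat.eq_zero_or_pos a with ha | ha
  · subst ha
    have : {y : ℕ | 1 ≤ y ∧ y ≤ 0} = ∅ := by
      ext y; simp; omega
    rw [this]; simp
  · have : IsGreatest {y | 1 ≤ y ∧ y ≤ a} a := ⟨⟨ha, le_rfl⟩, fun y hy => hy.2⟩
    exact this.csSup_eq

theorem phi_tlen {n l A} (h : Ch n l A) : tlen (Phi l A) = l := by
  unfold tlen
  have : {v | v ≠ 0 ∧ ∃ b, Phi l A b = v} = {v | 1 ≤ v ∧ v ≤ l} := by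
    ext v
    constructor
    · rintro ⟨hv, ⟨x, y⟩, rfl⟩
      exact ⟨by omega, phi_le_l h x y⟩
    · rintro ⟨h1, h2⟩
      refine ⟨by omega, ?_⟩
      obtain ⟨b, hb⟩ := phi_exists h (show v - 1 < l by omega)
      exact ⟨b, by omega⟩
  rw [this, sSup_Icc_one]

theorem phi_rowLen {n l A} (h : Ch n l A) (x : ℕ) : rowLen (Phi l A) x = dstair n x := by
  unfold rowLen dstair
  have : {y | Phi l A (x, y) ≠ 0} = {y | 1 ≤ y ∧ y ≤ if x = 0 then 0 else n - x} := by
    ext y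
    simp only [Set.mem_ofPred_eq]
    rw [phi_ne_zero h]
    split_ifs <;> omega
  rw [this, sSup_Icc_one]

theorem phi_tableau {n l A} (h : Ch n l A) : IsTableau (Phi l A) := by
  refine ⟨fun y => phi_nobox h (by omega), fun x => phi_nobox h (by omega), ?_, ?_, ?_, ?_, ?_⟩
  · apply (Set.finite_Iic ((n, n) : ℕ × ℕ)).subset
    rintro ⟨x, y⟩ hb
    have := (phi_ne_zero h).1 hb
    exact ⟨by simp; omega, by simp; omega⟩
  · intro x y x' y' h1 h2 h3 h4 h5
    rw [phi_ne_zero h] at h5 ⊢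
    omega
  · intro x y h1 h2
    have b1 := (phi_ne_zero h).1 h1
    have b2 := (phi_ne_zero h).1 h2
    obtain ⟨r, hr⟩ : ∃ r, Phi l A (x, y + 1) = r + 1 := ⟨_, (Nat.succ_pred h2).symm⟩
    rw [hr]
    have h3 := (phi_eq_succ h).1 hr
    have h4 := h.mono_succ r x
    have h5 := (phi_le h b1.1 b1.2.1 b1.2.2 r).2 (by omega)
    omega
  · intro x y h1 h2
    have b1 := (phi_ne_zero h).1 h1
    have b2 := (phi_ne_zero h).1 h2
    rw [phi_le h b1.1 b1.2.1 b1.2.2]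
    have h3 := (phi_le h b2.1 b2.2.1 b2.2.2 _).1 le_rfl
    have h4 := h.anti (Phi l A (x + 1, y)) x b1.1
    omega
  · intro v hv
    rw [phi_tlen h]
    constructor
    · intro hvl
      obtain ⟨b, hb⟩ := phi_exists h (show v - 1 < l by omega)
      exact ⟨b, by omega⟩
    · rintro ⟨⟨x, y⟩, rfl⟩
      exact phi_le_l h x y

theorem phi_inj {n l A B} (hA : Ch n l A) (hB : Ch n l B) (hAB : Phi l A = Phi l B) :
    A = B := by
  have key : ∀ {A B}, Ch n l A → Ch n l B → Phi l A = Phi l B → ∀ s x, A s x ≤ B s x := by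
    intro A B hA hB hAB s x
    by_contra hc
    have h1 := hA.ge s x
    have h2 := hB.ge s x
    have h3 := hA.le s x
    have hx : 1 ≤ x := by
      by_contra hx
      have : x = 0 := by omega
      subst this
      rw [hA.row0, hB.row0] at hc
      exact hc le_rfl
    have h4 := phi_le hA (x := x) (y := A s x - x) hx (by omega) (by omega) s
    have h5 := phi_le hB (x := x) (y := A s x - x) hx (by omega) (by omega) s
    rw [hAB] at h4
    omega
  funext s x
  exact le_antisymm (key hA hB hAB s x) (key hB hA hAB.symm s x)

theorem Ch.isDiagram {n l A} (h : Ch n l A) (s : ℕ) : IsDiagram (fun x => A s x - x) := by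
  refine ⟨by simp [h.row0], ?_, n, ?_⟩
  · intro x hx
    have := h.anti s x hx
    simp only
    omega
  · intro x hx
    have := h.le s x
    simp only
    omega

theorem Ch.isTamariChain {n l A} (h : Ch n l A) : IsTamariChain (fun s x => A s x - x) l := by
  refine ⟨fun r _ => h.isDiagram r, fun x => by simp [h.zero], ?_⟩
  intro r hr
  obtain ⟨p, e, hpe, hp, hlt, hb, hen, hef⟩ := h.step_data hr
  have hbe := hb e
  rw [if_pos (by omega)] at hbe
  have hbe1 := hb (e + 1)
  rw [if_neg (by omega)] at hbe1
  have hanti := h.anti r e (by omega)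
  have hge := h.ge r
  have hge' := h.ge (r + 1)
  have hph : primeHeight (fun x => A (r + 1) x - x) e = e - p := by
    unfold primeHeight
    have hmem : e - p ∈ {t | 1 ≤ t ∧ (t = e ∨ (t < e ∧ A (r + 1) e - e + t ≤
        A (r + 1) (e - t) - (e - t)))} := by
      refine ⟨by omega, ?_⟩
      rcases Nat.eq_zero_or_pos p with hp0 | hp0
      · left; omega
      · right
        have e1 : e - (e - p) = p := by omega
        have hbp := hb p
        rw [if_neg (by omega)] at hbp
        have := hge e
        have := hge p
        rw [e1]
        omega
    refine le_antisymm (Nat.sInf_le hmem) ?_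
    apply le_csInf ⟨_, hmem⟩
    rintro t ⟨ht1, ht2⟩
    by_contra hc
    have hbt := hb (e - t)
    rw [if_pos (by omega)] at hbt
    have := hlt (e - t) (by omega) (by omega)
    have := hge (e - t)
    have := hge e
    omega
  refine ⟨e, ⟨by omega, ?_, ?_⟩, ?_⟩
  · have := hge e
    simp only; omega
  · have := hge e
    have := hge (e + 1)
    simp only; omega
  · funext x
    unfold removeStrip
    rw [hph]
    have := hge x
    have := hb x
    simp only
    split_ifs at * <;> omega

/-- Convert a Tamari chain into an abstract chain. -/
theorem exists_ch {n l : ℕ} {Y : ℕ → ℕ → ℕ} (hY : IsTamariChain Y l)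
    (hfin : ∀ x, Y l x = dstair n x) : ∃ A, Ch n l A ∧ Phi l A = psiFun Y l := by
  let A : ℕ → ℕ → ℕ := fun s x => if s ≤ l then Y s x + x else if x = 0 then 0 else max x n
  have hAle : ∀ s x, s ≤ l → A s x = Y s x + x := fun s x hs => by simp [A, hs]
  refine ⟨A, ⟨?_, ?_, ?_⟩, ?_⟩
  · intro x
    rw [hAle 0 x (Nat.zero_le _), hY.2.1]; omega
  · intro s hs
    obtain ⟨d, ⟨hd1, hd2, hd3⟩, hmu⟩ := hY.2.2 s hs
    obtain ⟨h, hh⟩ : ∃ h, h = primeHeight (Y (s + 1)) d := ⟨_, rfl⟩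
    have hdiag := hY.1 (s + 1) hs
    have hanti : ∀ x, 1 ≤ x → x ≤ d → Y (s + 1) d ≤ Y (s + 1) x := by
      intro x hx1 hx2
      induction d, hx2 using Nat.le_induction with
      | base => exact le_rfl
      | succ k hk ih =>
        have hanti' : ∀ k, x ≤ k → Y (s + 1) k ≤ Y (s + 1) x := by
          intro k hk
          induction k, hk using Nat.le_induction with
          | base => exact le_rfl
          | succ k hk ih => exact (hdiag.2.1 k (by omega)).trans ih
        exact hanti' _ (by omega)
    have hmem : h ∈ {t | 1 ≤ t ∧ (t = d ∨ (t < d ∧ Y (s + 1) d + t ≤ Y (s + 1) (d - t)))} := by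
      rw [hh]
      exact Nat.sInf_mem ⟨d, hd1, Or.inl rfl⟩
    have hmin : ∀ t, 1 ≤ t → t < h → ¬ (t = d ∨ (t < d ∧ Y (s + 1) d + t ≤ Y (s + 1) (d - t))) := by
      intro t ht1 ht2 hc
      rw [hh] at ht2
      exact Nat.notMem_of_lt_sInf ht2 ⟨ht1, hc⟩
    have hle : h ≤ d := by
      rcases hmem.2 with h1 | h1 <;> omega
    have hval : ∀ x, Y s x = if d + 1 ≤ x + h ∧ x ≤ d then Y (s + 1) x - 1 else Y (s + 1) x := by
      intro x
      rw [hmu, hh]; rfl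
    have h1 := hmem.1
    have hvd := hval d
    rw [if_pos (by omega)] at hvd
    refine ⟨d - h, d, by omega, ?_, ?_, ?_⟩
    · rcases hmem.2 with h2 | h2
      · left; omega
      · right
        rw [hAle _ _ hs.le, hAle _ _ hs.le, hval (d - h), if_neg (by omega)]
        omega
    · intro x hx1 hx2
      have := hmin (d - x) (by omega) (by omega)
      have e1 : d - (d - x) = x := by omega
      rw [e1] at this
      have h3 := hanti x (by omega) (by omega)
      rw [hAle _ _ hs.le, hAle _ _ hs.le, hval x, if_pos (by omega)]
      omega
    · intro x
      rw [hAle (s + 1) x (by omega), hAle _ _ hs.le, hval x]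
      by_cases hx : d - h < x ∧ x ≤ d
      · have h3 := hanti x (by omega) (by omega)
        rw [if_pos hx, if_pos (by omega)]
        omega
      · rw [if_neg hx, if_neg (by omega)]
  · intro s hs x
    rcases Nat.lt_or_ge l s with h | h
    · simp [A, Nat.not_le.2 h]
    · have : s = l := by omega
      subst this
      rw [hAle _ _ le_rfl, hfin]
      unfold dstair
      split_ifs <;> omega
  · funext b
    unfold Phi psiFun
    have : ∀ r, r ≤ l → A r b.1 - b.1 = Y r b.1 := by
      intro r hr
      rw [hAle _ _ hr]; omega
    have hset : {r | r ≤ l ∧ b.2 ≤ A r b.1 - b.1} = {r | r ≤ l ∧ b.2 ≤ Y r b.1} := by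
      ext r
      simp only [Set.mem_ofPred_eq]
      constructor
      · rintro ⟨h1, h2⟩
        rw [this r h1] at h2
        exact ⟨h1, h2⟩
      · rintro ⟨h1, h2⟩
        rw [← this r h1] at h2
        exact ⟨h1, h2⟩
    have hl := this l le_rfl
    by_cases hb : 1 ≤ b.1 ∧ 1 ≤ b.2 ∧ b.2 ≤ Y l b.1
    · rw [if_pos hb, if_pos ⟨hb.1, hb.2.1, hb.2.2.trans hl.ge⟩]
      exact congrArg sInf hset
    · rw [if_neg hb, if_neg (fun h => hb ⟨h.1, h.2.1, h.2.2.trans hl.le⟩)]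

theorem psi_rowLen {l : ℕ} {Y : ℕ → ℕ → ℕ} (hY : IsTamariChain Y l) (x : ℕ) :
    rowLen (psiFun Y l) x = Y l x := by
  unfold rowLen
  have : {y | psiFun Y l (x, y) ≠ 0} = {y | 1 ≤ y ∧ y ≤ Y l x} := by
    ext y
    simp only [Set.mem_ofPred_eq]
    unfold psiFun
    simp only
    constructor
    · intro hne
      by_contra hc
      rw [if_neg (by tauto)] at hne
      exact hne rfl
    · rintro ⟨h1, h2⟩
      have hx : 1 ≤ x := by
        by_contra hx
        have : x = 0 := by omega
        subst this
        rw [(hY.1 l le_rfl).1] at h2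
        omega
      rw [if_pos ⟨hx, h1, h2⟩]
      have hmem := Nat.sInf_mem (s := {r | r ≤ l ∧ y ≤ Y r x}) ⟨l, le_rfl, h2⟩
      intro h0
      rw [h0] at hmem
      have := hmem.2
      rw [hY.2.1] at this
      omega
  rw [this, sSup_Icc_one]

theorem memC_iff {i : ℤ} {n l : ℕ} (hl : (l : ℤ) = n + i) (f : ℕ × ℕ → ℕ) :
    MemC i n f ↔ ∃ A, Ch n l A ∧ Phi l A = f := by
  constructor
  · rintro ⟨hT, ⟨l', Y, hY, rfl⟩, hrow, hlen⟩
    obtain ⟨A, hA, hphi⟩ := exists_ch (n := n) hY (fun x => by rw [← psi_rowLen hY, hrow])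
    rw [← hphi, phi_tlen hA] at hlen
    have : l' = l := by omega
    subst this
    exact ⟨A, hA, hphi⟩
  · rintro ⟨A, hA, rfl⟩
    exact ⟨phi_tableau hA, ⟨l, _, hA.isTamariChain, rfl⟩, phi_rowLen hA, by
      rw [phi_tlen hA]; exact hl⟩

theorem plus_iff {n l A} (h : Ch n l A) (r : ℕ) :
    HasPlusFullSet (Phi l A) n (r + 1) ↔ Plus A n r := by
  constructor
  · rintro ⟨k, ⟨⟨y, hy⟩, hk1, hkn, hfk, hend⟩, hplus⟩
    have b1 := (phi_eq_succ h).1 hfk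
    have b2 := (phi_eq_succ h).1 hy
    have hrl : r < l := by
      have := phi_le_l h k (n - k)
      omega
    obtain ⟨p, e, hpe, hp, hlt, hb, hen, hef⟩ := h.step_data hrl
    have hbk := hb k
    have hb1 := hb 1
    have hbe := hb e
    rw [if_pos (by omega)] at hbe
    have hek : e ≤ k := by
      apply hend e (A r e + 1 - e)
      rw [phi_eq_succ h]
      have := h.ge r e
      omega
    have hke : k = e := by
      split_ifs at hbk with hc
      · omega
      · omega
    have hp0 : p = 0 := by
      split_ifs at hb1 with hc
      · omega
      · omega
    subst hke
    subst hp0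
    refine ⟨k, ⟨by omega, ?_, ?_⟩, ⟨hk1, by omega, ?_⟩⟩
    · rcases hplus with hk | ⟨hk, hlt'⟩
      · have := h.ge r (k + 1)
        omega
      · have := (phi_le h (x := k + 1) (y := n - k - 1) (by omega) (by omega) (by omega) r).1
          (by omega)
        omega
    · intro x hx1 hx2
      rcases Nat.lt_or_ge x k with hx | hx
      · have := hlt x (by omega) hx
        omega
      · have : x = k := by omega
        subst this; exact hef
    · intro x hx1 hx2
      have := hlt x (by omega) hx2
      rw [hb, if_pos (by omega)]
      omega
  · rintro ⟨k, h1, h2⟩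
    have hn : 1 ≤ n := by
      have := h1.2.2 k h2.1 (by omega)
      omega
    have hkn := h.isD_le hn h1
    have hk1 := h2.1
    have hrl : r < l := by
      by_contra hc
      exact h.no_plus_ge (not_lt.1 hc) ⟨k, h1, h2⟩
    obtain ⟨hQ, hQlt, hQD⟩ := h.plus_step hn hrl h1 h2
    refine ⟨k, ⟨⟨A r 1, ?_⟩, hk1, by omega, ?_, ?_⟩, ?_⟩
    · rw [phi_eq_succ h]
      have a1 := hQ 1
      rw [if_pos (by omega)] at a1
      have a2 := h.ge r 1
      have a3 := h1.2.2 1 le_rfl (by omega)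
      omega
    · rw [phi_eq_succ h]
      have := hQ k
      rw [if_pos (by omega)] at this
      omega
    · intro x y hxy
      have a1 := (phi_eq_succ h).1 hxy
      have a2 := hQ x
      split_ifs at a2 with hc
      · exact hc.2
      · omega
    · rcases Nat.lt_or_ge (k + 1) n with hk | hk
      · right
        refine ⟨by omega, ?_⟩
        have := (phi_le h (x := k + 1) (y := n - k - 1) (by omega) (by omega) (by omega) r).2
          (by have := h1.2.1; omega)
        omega
      · left; omega

theorem noplus_iff {n l A} (h : Ch n l A) :
    (∀ r, ¬ HasPlusFullSet (Phi l A) n r) ↔ ∀ s, ¬ Plus A n s := by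
  constructor
  · intro hr s
    rw [← plus_iff h]
    exact hr _
  · intro hs r
    cases r with
    | zero =>
      rintro ⟨k, ⟨_, hk1, hk2, hk3, _⟩, _⟩
      have := (phi_ne_zero h (x := k) (y := n - k)).2 (by omega)
      exact this hk3
    | succ r =>
      rw [plus_iff h]
      exact hs r

theorem ncard_C {i : ℤ} {n l : ℕ} (hl : (l : ℤ) = n + i) :
    Set.ncard {C : ℕ × ℕ → ℕ | MemC i n C} = (G n l 0).ncard := by
  have : {C : ℕ × ℕ → ℕ | MemC i n C} = Phi l '' G n l 0 := by
    ext f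
    rw [G_zero]
    exact memC_iff hl f
  rw [this]
  apply Set.InjOn.ncard_image
  intro A hA B hB hAB
  exact phi_inj hA.1 hB.1 hAB

theorem ncard_N {i : ℤ} {n l : ℕ} (hl : (l : ℤ) = n + i) :
    Set.ncard {C : ℕ × ℕ → ℕ | MemN i n C} = (G n l l).ncard := by
  have : {C : ℕ × ℕ → ℕ | MemN i n C} = Phi l '' G n l l := by
    ext f
    rw [G_full]
    constructor
    · rintro ⟨hC, hN⟩
      obtain ⟨A, hA, rfl⟩ := (memC_iff hl f).1 hC
      exact ⟨A, ⟨hA, (noplus_iff hA).1 hN⟩, rfl⟩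
    · rintro ⟨A, ⟨hA, hN⟩, rfl⟩
      exact ⟨(memC_iff hl _).2 ⟨A, hA, rfl⟩, (noplus_iff hA).2 hN⟩
  rw [this]
  apply Set.InjOn.ncard_image
  intro A hA B hB hAB
  exact phi_inj hA.1 hB.1 hAB

/-! ### Final assembly -/

theorem sum_Icc_one {M : Type*} [AddCommMonoid M] (N : ℕ) (f : ℕ → M) :
    ∑ t ∈ Finset.Icc 1 N, f t = ∑ t ∈ Finset.range N, f (t + 1) := by
  induction N with
  | zero => simp
  | succ N ih => rw [Finset.sum_Icc_succ_top (by omega), ih, Finset.sum_range_succ]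

theorem G_formula' (m k : ℕ) : (G (k + 1) (k + m) 0).ncard =
    ∑ t ∈ Finset.range (2 * m + 1), Nat.choose (k + m) (t + m) *
      (G (t + 1) (t + m) (t + m)).ncard := by
  rw [G_formula m k 0 (Nat.zero_le _)]
  have h1 : ∑ t ∈ Finset.range (k + 1), Nat.choose (k + m - 0) (k - t) *
      (G (t + 1) (t + m) (t + m)).ncard = ∑ t ∈ Finset.range (k + 1), Nat.choose (k + m) (t + m) *
      (G (t + 1) (t + m) (t + m)).ncard := by
    apply Finset.sum_congr rfl
    intro t ht
    have := Finset.mem_range.1 ht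
    rw [Nat.sub_zero, Nat.choose_symm_of_eq_add (show k + m = (k - t) + (t + m) by omega)]
  rw [h1]
  have h2 : Finset.range (k + 1) ⊆ Finset.range (k + 1 + (2 * m + 1)) :=
    Finset.range_subset_range.2 (by omega)
  have h3 : Finset.range (2 * m + 1) ⊆ Finset.range (k + 1 + (2 * m + 1)) :=
    Finset.range_subset_range.2 (by omega)
  rw [Finset.sum_subset h2, ← Finset.sum_subset h3]
  · intro t _ ht
    rw [Finset.mem_range] at ht
    rw [G_vanish (by omega), mul_zero]
  · intro t _ ht
    rw [Finset.mem_range] at ht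
    rw [Nat.choose_eq_zero_of_lt (by omega), zero_mul]

open Polynomial in
theorem exists_poly (m : ℕ) (N : ℕ → ℕ) (hN : N (2 * m) ≠ 0) :
    ∃ p : Polynomial ℚ, p.degree = ((3 * m : ℕ) : WithBot ℕ) ∧
      ∀ k : ℕ, p.eval ((k + 1 : ℕ) : ℚ) =
        ((∑ t ∈ Finset.range (2 * m + 1), Nat.choose (k + m) (t + m) * N t : ℕ) : ℚ) := by
  let q : ℕ → ℚ[X] := fun t => (descPochhammer ℚ (t + m)).comp (X + C ((m : ℚ) - 1))
  have hq : ∀ t, (q t).degree = ((t + m : ℕ) : WithBot ℕ) := by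
    intro t
    have hm : (q t).Monic := (monic_descPochhammer ℚ (t + m)).comp (monic_X_add_C _)
      (by rw [natDegree_X_add_C]; exact one_ne_zero)
    rw [degree_eq_natDegree hm.ne_zero]
    simp only [q]
    rw [natDegree_comp, descPochhammer_natDegree, natDegree_X_add_C, mul_one]
  let c : ℕ → ℚ := fun t => (N t : ℚ) / ((t + m).factorial : ℚ)
  have hc : c (2 * m) ≠ 0 := by
    simp only [c]
    positivity
  refine ⟨∑ t ∈ Finset.range (2 * m + 1), C (c t) * q t, ?_, ?_⟩
  · have h1 : (C (c (2 * m)) * q (2 * m)).degree = ((3 * m : ℕ) : WithBot ℕ) := by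
      rw [degree_C_mul hc, hq]
      congr 1
      ring
    rw [Finset.sum_range_succ, degree_add_eq_right_of_degree_lt, h1]
    rw [h1]
    refine lt_of_le_of_lt (degree_sum_le _ _) ?_
    rw [Finset.sup_lt_iff (WithBot.bot_lt_coe _)]
    intro t ht
    have ht := Finset.mem_range.1 ht
    rw [← smul_eq_C_mul]
    refine lt_of_le_of_lt (degree_smul_le _ _) ?_
    rw [hq]
    exact_mod_cast (show t + m < 3 * m by omega)
  · intro k
    rw [eval_finsetSum]
    push_cast
    apply Finset.sum_congr rfl
    intro t _
    simp only [q, c, eval_mul, eval_C, eval_comp, eval_add, eval_X]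
    have : (k : ℚ) + 1 + (m - 1) = ((k + m : ℕ) : ℚ) := by push_cast; ring
    rw [this, descPochhammer_eval_eq_descFactorial, Nat.descFactorial_eq_factorial_mul_choose]
    have : ((t + m).factorial : ℚ) ≠ 0 := by positivity
    push_cast
    field_simp


/-- **Theorem 5.8 (main theorem).**  For each `i ≥ -1` and all `n ≥ 1`, the number of maximal
chains of length `n + i` in the Tamari lattice `T_n` is
`#C_i(n) = ∑_{t=1}^{2i+3} C(n+i, t+i) ⬝ #N_i(t)`, a polynomial in `n` of degree `3i + 3`;
moreover `#N_i(n) = ∑_{t=1}^{n} (-1)^{n-t} C(n+i, t+i) ⬝ #C_i(t)`. -/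
theorem maximal_chain_count_formula (i : ℤ) (hi : -1 ≤ i) :
    (∀ n : ℕ, 1 ≤ n →
      Set.ncard {C : ℕ × ℕ → ℕ | MemC i n C} =
        ∑ t ∈ Finset.Icc 1 (2 * i + 3).toNat,
          Nat.choose ((n : ℤ) + i).toNat ((t : ℤ) + i).toNat *
            Set.ncard {C : ℕ × ℕ → ℕ | MemN i t C}) ∧
    (∃ p : Polynomial ℚ, p.degree = ((3 * i + 3).toNat : WithBot ℕ) ∧
      ∀ n : ℕ, 1 ≤ n → p.eval (n : ℚ) = Set.ncard {C : ℕ × ℕ → ℕ | MemC i n C}) ∧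
    (∀ n : ℕ, 1 ≤ n →
      (Set.ncard {C : ℕ × ℕ → ℕ | MemN i n C} : ℤ) =
        ∑ t ∈ Finset.Icc 1 n,
          (-1 : ℤ) ^ (n - t) * (Nat.choose ((n : ℤ) + i).toNat ((t : ℤ) + i).toNat : ℤ) *
            (Set.ncard {C : ℕ × ℕ → ℕ | MemC i t C} : ℤ)) := by
  obtain ⟨m, rfl⟩ : ∃ m : ℕ, i = (m : ℤ) - 1 := ⟨(i + 1).toNat, by omega⟩
  have hC : ∀ k : ℕ, Set.ncard {C : ℕ × ℕ → ℕ | MemC ((m : ℤ) - 1) (k + 1) C} =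
      (G (k + 1) (k + m) 0).ncard := fun k => ncard_C (by push_cast; ring)
  have hN : ∀ k : ℕ, Set.ncard {C : ℕ × ℕ → ℕ | MemN ((m : ℤ) - 1) (k + 1) C} =
      (G (k + 1) (k + m) (k + m)).ncard := fun k => ncard_N (by push_cast; ring)
  have hT : ∀ k : ℕ, (((k + 1 : ℕ) : ℤ) + ((m : ℤ) - 1)).toNat = k + m := by
    intro k; omega
  have e1 : (2 * ((m : ℤ) - 1) + 3).toNat = 2 * m + 1 := by omega
  have e2 : (3 * ((m : ℤ) - 1) + 3).toNat = 3 * m := by omega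
  refine ⟨?_, ?_, ?_⟩
  · intro n hn
    obtain ⟨k, rfl⟩ : ∃ k, n = k + 1 := ⟨n - 1, by omega⟩
    rw [e1, sum_Icc_one, hC, G_formula']
    simp only [hN, hT]
  · have hpos : (G (2 * m + 1) (2 * m + m) (2 * m + m)).ncard ≠ 0 := by
      have := G_pos m
      rwa [show 3 * m = 2 * m + m by ring] at this
    obtain ⟨p, hp1, hp2⟩ := exists_poly m (fun t => (G (t + 1) (t + m) (t + m)).ncard) hpos
    refine ⟨p, by rw [hp1, e2], ?_⟩
    intro n hn
    obtain ⟨k, rfl⟩ : ∃ k, n = k + 1 := ⟨n - 1, by omega⟩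
    rw [hp2, hC, G_formula']
  · intro n hn
    obtain ⟨k, rfl⟩ : ∃ k, n = k + 1 := ⟨n - 1, by omega⟩
    rw [sum_Icc_one, hN, G_inverse m (k + m) k le_rfl]
    apply Finset.sum_congr rfl
    intro t ht
    have := Finset.mem_range.1 ht
    rw [hC, hT, hT, Nat.choose_symm_of_eq_add (show k + m = (k - t) + (t + m) by omega),
      show k + 1 - (t + 1) = k - t by omega]

end TamariMaxChains
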